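/- Let G=(V,E) be a mixed graph, S⊆V, and suppose π=⟨π₁,e,π₂,e,π₃⟩ is a p-connecting path given S in which the edge e between vertices u and v occurs twice with the same orientation. Then the shortened path π'=⟨π₁,e,π₃⟩ is also p-connecting given S. -/

import Mathlib

open MeasureTheory ProbabilityTheory Filter

noncomputable section

namespace GraphicalTS

/-! ### Mixed graphs, paths and p-separation -/

/-- A mixed graph on vertex type `V`, with directed edges `dir a b` (i.e. `a → b`)
and (symmetric) undirected edges `undir a b` (i.e. `a — b`). -/
structure MixedGraph (V : Type*) where
  dir : V → V → Prop
  undir : V → V → Prop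
  undir_symm : ∀ a b, undir a b → undir b a

namespace MixedGraph

variable {V : Type*}

/-- Parents of a set `A`: vertices `v ∉ A` with `v → a` for some `a ∈ A`. -/
def pa (G : MixedGraph V) (A : Set V) : Set V := {v | ∃ a ∈ A, G.dir v a} \ A

/-- Neighbours of a set `A`: vertices `v ∉ A` with `v — a` for some `a ∈ A`. -/
def nb (G : MixedGraph V) (A : Set V) : Set V := {v | ∃ a ∈ A, G.undir v a} \ A

/-- Children of a set `A`: vertices `v ∉ A` with `a → v` for some `a ∈ A`. -/
def ch (G : MixedGraph V) (A : Set V) : Set V := {v | ∃ a ∈ A, G.dir a v} \ A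

/-- `b` is an ancestor of `a`: `b = a` or there is a directed path `b → ⋯ → a`. -/
def ancestor (G : MixedGraph V) (b a : V) : Prop := Relation.ReflTransGen G.dir b a

/-- The set of ancestors of elements of `A`. -/
def anc (G : MixedGraph V) (A : Set V) : Set V := {b | ∃ a ∈ A, G.ancestor b a}

end MixedGraph

/-- The orientation of an edge as traversed along a path: forward directed (tail at the
current vertex, arrowhead at the next), backward directed, or undirected. -/
inductive EdgeKind : Type
  | fwd | bwd | un

/-- A path between `a` and `b` in the mixed graph `G`: a sequence of `n` edges along
vertices `vert 0 = a, vert 1, …, vert n = b`; vertices and edges may repeat.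
(`vert` and `kind` are total functions on `ℕ`; only the values `vert 0,…,vert n` and
`kind 0,…,kind (n-1)` are constrained.) -/
structure MGPath {V : Type*} (G : MixedGraph V) (a b : V) where
  n : ℕ
  vert : ℕ → V
  kind : ℕ → EdgeKind
  src : vert 0 = a
  tgt : vert n = b
  valid : ∀ i, i < n →
    (kind i = EdgeKind.fwd → G.dir (vert i) (vert (i + 1))) ∧
    (kind i = EdgeKind.bwd → G.dir (vert (i + 1)) (vert i)) ∧
    (kind i = EdgeKind.un → G.undir (vert i) (vert (i + 1)))

namespace MGPath

variable {V : Type*} {G : MixedGraph V} {a b : V}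

/-- The intermediate vertex at position `j` (for `0 < j < n`) is a p-collider: the two
adjacent edges form `→ c ←`, `→ c —` or `— c ←`. -/
def colliderAt (p : MGPath G a b) (j : ℕ) : Prop :=
  p.kind (j - 1) ≠ EdgeKind.bwd ∧ p.kind j ≠ EdgeKind.fwd ∧
    ¬(p.kind (j - 1) = EdgeKind.un ∧ p.kind j = EdgeKind.un)

/-- The path is p-connecting given `S`: every intermediate p-noncollider is outside `S`
and every intermediate p-collider is in `S`. -/
def pConnecting (p : MGPath G a b) (S : Set V) : Prop :=
  ∀ j, 0 < j → j < p.n →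
    (p.colliderAt j → p.vert j ∈ S) ∧ (¬p.colliderAt j → p.vert j ∉ S)

/-- The path has an arrowhead at its endpoint `b`. -/
def bPointing (p : MGPath G a b) : Prop :=
  0 < p.n ∧ p.kind (p.n - 1) = EdgeKind.fwd

/-- The path has arrowheads at both endpoints. -/
def biPointing (p : MGPath G a b) : Prop :=
  0 < p.n ∧ p.kind 0 = EdgeKind.bwd ∧ p.kind (p.n - 1) = EdgeKind.fwd

/-- The path consists of undirected edges only. -/
def undirected (p : MGPath G a b) : Prop := ∀ i, i < p.n → p.kind i = EdgeKind.un

/-- The path is a composition of finitely many subpaths, each of which is undirected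
or bi-pointing (cut points `c 0 = 0 < c 1 < ⋯ < c m = n`). -/
def extBiPointing (p : MGPath G a b) : Prop :=
  ∃ (m : ℕ) (c : ℕ → ℕ), c 0 = 0 ∧ c m = p.n ∧ (∀ k, k < m → c k < c (k + 1)) ∧
    ∀ k, k < m →
      (∀ i, c k ≤ i → i < c (k + 1) → p.kind i = EdgeKind.un) ∨
      (p.kind (c k) = EdgeKind.bwd ∧ p.kind (c (k + 1) - 1) = EdgeKind.fwd)

/-- Every intermediate vertex on the path is a p-collider. -/
def pureCollider (p : MGPath G a b) : Prop := ∀ j, 0 < j → j < p.n → p.colliderAt j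

/-- The path is a trail: all intermediate vertices are distinct. -/
def isTrail (p : MGPath G a b) : Prop :=
  ∀ i j, 0 < i → i < p.n → 0 < j → j < p.n → p.vert i = p.vert j → i = j

/-- The trail is p-active relative to `S` (Andersson–Madigan–Perlman): every p-collider
lies in `an(S)`, and every p-noncollider `v` either lies outside `S`, or its two adjacent
edges are undirected and `pa(v) ∖ S ≠ ∅`. -/
def pActive (p : MGPath G a b) (S : Set V) : Prop :=
  ∀ j, 0 < j → j < p.n →
    (p.colliderAt j → p.vert j ∈ G.anc S) ∧
    (¬p.colliderAt j →
      p.vert j ∉ S ∨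
        (p.kind (j - 1) = EdgeKind.un ∧ p.kind j = EdgeKind.un ∧
          ({v | G.dir v (p.vert j)} \ S).Nonempty))

end MGPath

/-- `A` and `B` are p-separated given `S`: every path between a vertex of `A` and a
vertex of `B` is p-blocked given `S`. -/
def pSeparated {V : Type*} (G : MixedGraph V) (A B S : Set V) : Prop :=
  ∀ a ∈ A, ∀ b ∈ B, ∀ p : MGPath G a b, ¬p.pConnecting S

/-- `a` and `b` are joined in `G` by an undirected path none of whose intermediate
vertices lies in `an(W) ∖ {a, b}`. -/
def undirAvoiding {V : Type*} (G : MixedGraph V) (W : Set V) (a b : V) : Prop :=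
  ∃ p : MGPath G a b, 0 < p.n ∧ p.undirected ∧
    ∀ j, 0 < j → j < p.n → p.vert j ∉ G.anc W \ {a, b}

/-- The marginal ancestral graph `G_[A]` (for an ancestral set `A`): the subgraph of `G`
induced by `A`, together with an additional undirected edge `a — b` for each pair
`a, b ∈ A` joined in `G` by an undirected path avoiding `an(A) ∖ {a, b}`. -/
def marginalGraph {V : Type*} (G : MixedGraph V) (A : Set V) : MixedGraph V where
  dir u v := G.dir u v ∧ u ∈ A ∧ v ∈ A
  undir u v := (G.undir u v ∧ u ∈ A ∧ v ∈ A) ∨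
    (u ∈ A ∧ v ∈ A ∧ (undirAvoiding G A u v ∨ undirAvoiding G A v u))
  undir_symm := by
    rintro x y (⟨h, hx, hy⟩ | ⟨hx, hy, h⟩)
    · exact Or.inl ⟨G.undir_symm _ _ h, hy, hx⟩
    · exact Or.inr ⟨hy, hx, h.symm⟩

/-! ### σ-algebras, conditional independence, Granger causality -/

variable {Ω : Type*}

/-- The `μ`-completion of a sub-σ-algebra `m`: the σ-algebra generated by `m` together
with all `μ`-null sets. -/
def mComplete [MeasurableSpace Ω] (μ : Measure Ω) (m : MeasurableSpace Ω) :
    MeasurableSpace Ω :=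
  m ⊔ MeasurableSpace.generateFrom {s : Set Ω | μ s = 0}

/-- `ℱ_A(t)`: the `μ`-completed σ-algebra generated by `{X_a(s) : a ∈ A, s ≤ t}`. -/
def pastSigma {V : Type*} [MeasurableSpace Ω] (μ : Measure Ω) (X : V → ℤ → Ω → ℝ)
    (A : Set V) (t : ℤ) : MeasurableSpace Ω :=
  mComplete μ (⨆ a ∈ A, ⨆ s ≤ t, MeasurableSpace.comap (X a s) inferInstance)

/-- Conditional independence `m₁ ⟂ m₂ | m₃` of sub-σ-algebras:
`E[1_G | m₂ ∨ m₃] = E[1_G | m₃]` a.s. for every `G ∈ m₁`. -/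
def CondIndepSigma [MeasurableSpace Ω] (μ : Measure Ω) (m₁ m₂ m₃ : MeasurableSpace Ω) :
    Prop :=
  ∀ s : Set Ω, MeasurableSet[m₁] s →
    μ[s.indicator fun _ => (1 : ℝ) | m₂ ⊔ m₃] =ᵐ[μ] μ[s.indicator fun _ => (1 : ℝ) | m₃]

/-- `X_A` is (strongly) Granger-noncausal for `X_B` with respect to `ℱ_S`
(`X_A ⇸ X_B [ℱ_S]`): `ℱ_B(t+1) ⟂ ℱ_A(t) | ℱ_{S∖A}(t)` for all `t`. -/
def GrangerNoncausal {V : Type*} [MeasurableSpace Ω] (μ : Measure Ω)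
    (X : V → ℤ → Ω → ℝ) (A B S : Set V) : Prop :=
  ∀ t : ℤ, CondIndepSigma μ (pastSigma μ X B (t + 1)) (pastSigma μ X A t)
    (pastSigma μ X (S \ A) t)

/-- `X_A` and `X_B` are contemporaneously conditionally independent with respect to
`ℱ_S` (`X_A ≁ X_B [ℱ_S]`): `ℱ_A(t+1) ⟂ ℱ_B(t+1) | ℱ_S(t) ∨ ℱ_{S∖(A∪B)}(t+1)`. -/
def ContempIndep {V : Type*} [MeasurableSpace Ω] (μ : Measure Ω)
    (X : V → ℤ → Ω → ℝ) (A B S : Set V) : Prop :=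
  ∀ t : ℤ, CondIndepSigma μ (pastSigma μ X A (t + 1)) (pastSigma μ X B (t + 1))
    (pastSigma μ X S t ⊔ pastSigma μ X (S \ (A ∪ B)) (t + 1))

/-! ### Granger-causal Markov properties (ground set `W`, usually `W = Set.univ`) -/

/-- (PC) the pairwise Granger-causal Markov property w.r.t. `G` (on ground set `W`). -/
def PairwiseMarkov {V : Type*} [MeasurableSpace Ω] (μ : Measure Ω)
    (X : V → ℤ → Ω → ℝ) (G : MixedGraph V) (W : Set V) : Prop :=
  ∀ a ∈ W, ∀ b ∈ W, a ≠ b →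
    (¬G.dir a b → GrangerNoncausal μ X {a} {b} W) ∧
    (¬G.undir a b → ContempIndep μ X {a} {b} W)

/-- (LC) the local Granger-causal Markov property w.r.t. `G` (on ground set `W`). -/
def LocalMarkov {V : Type*} [MeasurableSpace Ω] (μ : Measure Ω)
    (X : V → ℤ → Ω → ℝ) (G : MixedGraph V) (W : Set V) : Prop :=
  ∀ a ∈ W,
    GrangerNoncausal μ X (W \ (G.pa {a} ∪ {a})) {a} W ∧
    ContempIndep μ X (W \ (G.nb {a} ∪ {a})) {a} W

/-- (BC) the block-recursive Granger-causal Markov property w.r.t. `G`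
(on ground set `W`). -/
def BlockRecursiveMarkov {V : Type*} [MeasurableSpace Ω] (μ : Measure Ω)
    (X : V → ℤ → Ω → ℝ) (G : MixedGraph V) (W : Set V) : Prop :=
  ∀ A ⊆ W,
    GrangerNoncausal μ X (W \ (G.pa A ∪ A)) A W ∧
    ContempIndep μ X (W \ (G.nb A ∪ A)) A W

/-- (GC) the global Granger-causal Markov property w.r.t. `G`. -/
def GlobalMarkov {V : Type*} [MeasurableSpace Ω] (μ : Measure Ω)
    (X : V → ℤ → Ω → ℝ) (G : MixedGraph V) : Prop :=
  ∀ A B S : Set V, Disjoint A B → Disjoint A S → Disjoint B S →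
    ((∀ a ∈ A, ∀ b ∈ B, ∀ p : MGPath G a b, p.bPointing → ¬p.pConnecting (S ∪ B)) →
      GrangerNoncausal μ X A B (A ∪ B ∪ S)) ∧
    ((∀ a ∈ A, ∀ b ∈ B, ∀ p : MGPath G a b, p.extBiPointing →
        ¬p.pConnecting (A ∪ B ∪ S)) →
      ContempIndep μ X A B (A ∪ B ∪ S))

/-! ### Conditions (M) and (P) -/

/-- Stationarity: the joint law of `(X_V(t+s))_{s∈ℤ}` does not depend on `t`. -/
def Stationary {V : Type*} [MeasurableSpace Ω] (μ : Measure Ω)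
    (X : V → ℤ → Ω → ℝ) : Prop :=
  ∀ t : ℤ,
    Measure.map (fun ω => fun q : ℤ × V => X q.2 (t + q.1) ω) μ =
    Measure.map (fun ω => fun q : ℤ × V => X q.2 q.1 ω) μ

/-- Strong mixing: `sup |P(S₁ ∩ S₂) − P(S₁) P(S₂)| → 0` as `k → ∞`, the supremum being
over `S₁ ∈ σ(X_V(s) : s ≤ t)` and `S₂ ∈ σ(X_V(s) : s ≥ t + k)`. -/
def StrongMixing {V : Type*} [MeasurableSpace Ω] (μ : Measure Ω)
    (X : V → ℤ → Ω → ℝ) : Prop :=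
  ∀ t : ℤ, ∀ ε > (0 : ℝ), ∃ K : ℕ, ∀ k : ℕ, K ≤ k → ∀ S₁ S₂ : Set Ω,
    MeasurableSet[⨆ (v : V), ⨆ s ≤ t, MeasurableSpace.comap (X v s) inferInstance] S₁ →
    MeasurableSet[⨆ (v : V), ⨆ (s : ℤ) (_ : t + k ≤ s),
      MeasurableSpace.comap (X v s) inferInstance] S₂ →
    |(μ (S₁ ∩ S₂)).toReal - (μ S₁).toReal * (μ S₂).toReal| ≤ ε

/-- Condition (M): the process is stationary and strongly mixing. -/
def ConditionM {V : Type*} [MeasurableSpace Ω] (μ : Measure Ω)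
    (X : V → ℤ → Ω → ℝ) : Prop :=
  Stationary μ X ∧ StrongMixing μ X

/-- `ν` is a product measure on `ℝ^V`. -/
def IsProductMeasure {V : Type*} [Fintype V] (ν : Measure (V → ℝ)) : Prop :=
  ∃ νv : V → Measure ℝ, ∀ B : V → Set ℝ, (∀ v, MeasurableSet (B v)) →
    ν (Set.univ.pi B) = ∏ v, νv v (B v)

/-- The past trajectory `(X_V(s))_{s ≤ t}` of the process at time `t`. -/
def pastTraj {V : Type*} (X : V → ℤ → Ω → ℝ) (t : ℤ) (ω : Ω) : ℤ → V → ℝ :=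
  fun s v => if s ≤ t then X v s ω else 0

/-- Condition (P): the conditional distribution of `X_V(t+1)` given the past
`(X_V(s))_{s≤t}` has a regular version (a Markov kernel `κ` applied to the past
trajectory) that is almost surely absolutely continuous with respect to some product
measure `ν` on `ℝ^V` with a `ν`-a.e. positive and continuous density `f`. -/
def ConditionP {V : Type*} [Fintype V] [MeasurableSpace Ω] (μ : Measure Ω)
    (X : V → ℤ → Ω → ℝ) : Prop :=
  ∃ ν : Measure (V → ℝ), IsProductMeasure ν ∧
    ∀ t : ℤ, ∃ (κ : Kernel (ℤ → V → ℝ) (V → ℝ)) (f : (ℤ → V → ℝ) → (V → ℝ) → ℝ),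
      IsMarkovKernel κ ∧
      (∀ B : Set (V → ℝ), MeasurableSet B →
        (μ[fun ω => B.indicator (fun _ => (1 : ℝ)) (fun v => X v (t + 1) ω) |
            pastSigma μ X Set.univ t]) =ᵐ[μ]
          fun ω => (κ (pastTraj X t ω) B).toReal) ∧
      (∀ᵐ ω ∂μ,
        κ (pastTraj X t ω) =
          ν.withDensity (fun y => ENNReal.ofReal (f (pastTraj X t ω) y)) ∧
        (∀ᵐ y ∂ν, 0 < f (pastTraj X t ω) y ∧ ContinuousAt (f (pastTraj X t ω)) y))


/-- Lemma: removing a repeated edge from a p-connecting path.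
If `π = ⟨π₁, e, π₂, e, π₃⟩` is p-connecting given `S`, where the edge `e` occurs at
positions `i < j` with the same orientation (same endpoints in the same order and the
same kind), then the shortened path `π' = ⟨π₁, e, π₃⟩` — the path with the segment
between the two occurrences of `e` removed — is also p-connecting given `S`. -/
theorem shortened_path_pConnecting
    {V : Type*} (G : MixedGraph V) (S : Set V) (a b : V)
    (p : MGPath G a b) (hp : p.pConnecting S)
    (i j : ℕ) (hij : i < j) (hjn : j < p.n)
    (hu : p.vert i = p.vert j) (hv : p.vert (i + 1) = p.vert (j + 1))
    (hk : p.kind i = p.kind j) :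
    ∃ q : MGPath G a b, q.n = p.n - (j - i) ∧
      (∀ m, m ≤ i → q.vert m = p.vert m) ∧
      (∀ m, i < m → q.vert m = p.vert (m + (j - i))) ∧
      (∀ m, m ≤ i → q.kind m = p.kind m) ∧
      (∀ m, i < m → q.kind m = p.kind (m + (j - i))) ∧
      q.pConnecting S := by
  have hcol : ∀ m, i < m →
      (if m - 1 ≤ i then p.kind (m - 1) else p.kind (m - 1 + (j - i))) =
        p.kind (m + (j - i) - 1) := by
    intro m hm
    split_ifs with h
    · rw [show m - 1 = i by lia, show m + (j - i) - 1 = j by lia, hk]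
    · congr 1
      lia
  refine ⟨
    { n := p.n - (j - i)
      vert := fun m => if m ≤ i then p.vert m else p.vert (m + (j - i))
      kind := fun m => if m ≤ i then p.kind m else p.kind (m + (j - i))
      src := by simp [p.src]
      tgt := by
        rw [if_neg (by lia), show p.n - (j - i) + (j - i) = p.n by lia, p.tgt]
      valid := ?_ }, rfl, fun m hm => if_pos hm, fun m hm => if_neg (not_le.2 hm),
      fun m hm => if_pos hm, fun m hm => if_neg (not_le.2 hm), ?_⟩
  · intro m hm
    rcases lt_trichotomy m i with h | rfl | h
    · simpa only [if_pos h.le, if_pos (Nat.succ_le_of_lt h)] using p.valid m (by lia)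
    · have hnot : ¬m + 1 ≤ m := by lia
      have hend : m + 1 + (j - m) = j + 1 := by lia
      simpa only [if_pos le_rfl, if_neg hnot, hend, ← hv] using p.valid m (by lia)
    · have hnot : ¬m + 1 ≤ i := by lia
      have hshift : m + 1 + (j - i) = m + (j - i) + 1 := by lia
      simpa only [if_neg (not_le.2 h), if_neg hnot, hshift] using p.valid (m + (j - i)) (by lia)
  · intro m hm hmn
    dsimp only at hmn ⊢
    rcases le_or_gt m i with h | h
    · have hpred : m - 1 ≤ i := by lia
      simpa only [MGPath.colliderAt, if_pos h, if_pos hpred] using hp m hm (by lia)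
    · simpa only [MGPath.colliderAt, hcol m h, if_neg (not_le.2 h)]
        using hp (m + (j - i)) (by lia) (by lia)

end GraphicalTS
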